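/- There is a constant C > 0 such that for every ω ≥ 1 and every Schwartz function f on ℝ³ = ℝ² × ℝ (variables (x,z)), one has ‖f‖_{L^∞(ℝ³)} ≤ C ω^{1/4} ‖S²f‖_{L²(ℝ³)}, where S²f = (1−ω) f − Δ f + ω² z² f. -/

import Mathlib

open MeasureTheory Complex

noncomputable section

/-- ℝ² with the Euclidean norm. -/
abbrev R2 : Type := EuclideanSpace ℝ (Fin 2)

/-- ℝ³ written as ℝ² × ℝ, points r = (x, z). -/
abbrev R3 : Type := R2 × ℝ

/-- Directional derivative of `f` at `p` in the direction `v`. -/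
def pd {E F : Type*} [NormedAddCommGroup E] [NormedSpace ℝ E]
    [NormedAddCommGroup F] [NormedSpace ℝ F] (v : E) (f : E → F) (p : E) : F :=
  fderiv ℝ f p v

/-- Second directional derivative in the direction `v`. -/
def pd2 {E F : Type*} [NormedAddCommGroup E] [NormedSpace ℝ E]
    [NormedAddCommGroup F] [NormedSpace ℝ F] (v : E) (f : E → F) (p : E) : F :=
  pd v (pd v f) p

/-- First coordinate direction in the x-plane. -/
def ex0 : R3 := (EuclideanSpace.single 0 1, 0)

/-- Second coordinate direction in the x-plane. -/
def ex1 : R3 := (EuclideanSpace.single 1 1, 0)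

/-- The z-direction. -/
def ez : R3 := (0, 1)

/-- The full Laplacian on ℝ³ = ℝ² × ℝ. -/
def lap3 {F : Type*} [NormedAddCommGroup F] [NormedSpace ℝ F]
    (f : R3 → F) (p : R3) : F :=
  pd2 ex0 f p + pd2 ex1 f p + pd2 ez f p

/-- The operator `S² f = (1−ω)f − Δf + ω² z² f` on functions on ℝ³. -/
def S2op (ω : ℝ) (f : R3 → ℂ) (p : R3) : ℂ :=
  ((1 - ω : ℝ) : ℂ) * f p - lap3 f p + ((ω ^ 2 * p.2 ^ 2 : ℝ) : ℂ) * f p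

/-- The inner product of two square-integrable functions is integrable. -/
lemma integrable_inner_of_memLp_two {α E : Type*} [MeasurableSpace α] {μ : Measure α}
    [NormedAddCommGroup E] [InnerProductSpace ℝ E] {f g : α → E}
    (hf : MemLp f 2 μ) (hg : MemLp g 2 μ) : Integrable (fun z => inner ℝ (f z) (g z)) μ :=
  (hf.norm.integrable_mul hg.norm).mono' (hf.1.inner hg.1)
    (Filter.Eventually.of_forall fun z => norm_inner_le_norm (f z) (g z))

/-- Pointwise control of a function on the line by the `L²` norms of it and its derivative. -/
lemma norm_sq_le_of_hasDerivAt {E : Type*} [NormedAddCommGroup E] [InnerProductSpace ℝ E]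
    {u v : ℝ → E} (hu : ∀ z, HasDerivAt u (v z) z)
    (hu2 : MemLp u 2) (hv2 : MemLp v 2) {ε : ℝ} (hε : 0 < ε) (a : ℝ) :
    ‖u a‖ ^ 2 ≤ ε * (∫ z, ‖u z‖ ^ 2) + ε⁻¹ * ∫ z, ‖v z‖ ^ 2 := by
  have hiu : Integrable (fun z => ‖u z‖ ^ 2) := (memLp_two_iff_integrable_sq_norm hu2.1).1 hu2
  have hiv : Integrable (fun z => ‖v z‖ ^ 2) := (memLp_two_iff_integrable_sq_norm hv2.1).1 hv2
  have hd : ∀ z, HasDerivAt (fun z => ‖u z‖ ^ 2) (2 * inner ℝ (u z) (v z)) z :=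
    fun z => (hu z).norm_sq
  have hid : Integrable (fun z => 2 * inner ℝ (u z) (v z)) :=
    (integrable_inner_of_memLp_two hu2 hv2).const_mul 2
  have hlim : Filter.Tendsto (fun z => ‖u z‖ ^ 2) Filter.atBot (nhds 0) :=
    tendsto_zero_of_hasDerivAt_of_integrableOn_Iic (a := a) (fun z _ => hd z)
      hid.integrableOn hiu.integrableOn
  have hint := integral_Iic_of_hasDerivAt_of_tendsto' (a := a) (fun z _ => hd z)
    hid.integrableOn hlim
  have hb : Integrable (fun z => ε * ‖u z‖ ^ 2 + ε⁻¹ * ‖v z‖ ^ 2) :=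
    (hiu.const_mul ε).add (hiv.const_mul ε⁻¹)
  have hpt : ∀ z, 2 * inner ℝ (u z) (v z) ≤ ε * ‖u z‖ ^ 2 + ε⁻¹ * ‖v z‖ ^ 2 := by
    intro z
    have h1 := real_inner_le_norm (u z) (v z)
    have h2 : ε * ‖u z‖ ^ 2 + ε⁻¹ * ‖v z‖ ^ 2 - 2 * (‖u z‖ * ‖v z‖)
        = ε⁻¹ * (ε * ‖u z‖ - ‖v z‖) ^ 2 := by
      field_simp
      ring
    have h3 : 0 ≤ ε⁻¹ * (ε * ‖u z‖ - ‖v z‖) ^ 2 := by positivity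
    linarith
  calc ‖u a‖ ^ 2 = ∫ z in Set.Iic a, 2 * inner ℝ (u z) (v z) := by rw [hint]; ring
    _ ≤ ∫ z in Set.Iic a, (ε * ‖u z‖ ^ 2 + ε⁻¹ * ‖v z‖ ^ 2) :=
      setIntegral_mono hid.integrableOn hb.integrableOn hpt
    _ ≤ ∫ z, (ε * ‖u z‖ ^ 2 + ε⁻¹ * ‖v z‖ ^ 2) :=
      setIntegral_le_integral hb (Filter.Eventually.of_forall fun z => by positivity)
    _ = _ := by
      rw [integral_add (hiu.const_mul ε) (hiv.const_mul ε⁻¹), integral_const_mul,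
        integral_const_mul]

/-- Energy estimate for the shifted harmonic oscillator `l - ω - ∂² + ω²z²` on the line. -/
lemma norm_sq_le_of_oscillator {E : Type*} [NormedAddCommGroup E] [InnerProductSpace ℝ E]
    {u v w h : ℝ → E} {ω l : ℝ} (hω : 1 ≤ ω) (hl : 1 ≤ l)
    (hu : ∀ z, HasDerivAt u (v z) z) (hv : ∀ z, HasDerivAt v (w z) z)
    (hu2 : MemLp u 2) (hv2 : MemLp v 2) (hw2 : MemLp w 2)
    (hzu2 : MemLp (fun z => z • u z) 2) (hh2 : MemLp h 2)
    (hh : ∀ z, h z = (l - ω + ω ^ 2 * z ^ 2) • u z - w z) (a : ℝ) :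
    ‖u a‖ ^ 2 ≤ 3 * √ω / (l * √l) * ∫ z, ‖h z‖ ^ 2 := by
  have hiu : Integrable (fun z => ‖u z‖ ^ 2) := (memLp_two_iff_integrable_sq_norm hu2.1).1 hu2
  have hiv : Integrable (fun z => ‖v z‖ ^ 2) := (memLp_two_iff_integrable_sq_norm hv2.1).1 hv2
  have hih : Integrable (fun z => ‖h z‖ ^ 2) := (memLp_two_iff_integrable_sq_norm hh2.1).1 hh2
  have hizu : Integrable (fun z => ‖z • u z‖ ^ 2) :=
    (memLp_two_iff_integrable_sq_norm hzu2.1).1 hzu2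
  have hiuv : Integrable (fun z => inner ℝ (u z) (v z)) := integrable_inner_of_memLp_two hu2 hv2
  have hiuw : Integrable (fun z => inner ℝ (u z) (w z)) := integrable_inner_of_memLp_two hu2 hw2
  have hiuh : Integrable (fun z => inner ℝ (u z) (h z)) := integrable_inner_of_memLp_two hu2 hh2
  have hizuv : Integrable (fun z => inner ℝ (z • u z) (v z)) := integrable_inner_of_memLp_two hzu2 hv2
  have hizuu : Integrable (fun z => inner ℝ (z • u z) (u z)) := integrable_inner_of_memLp_two hzu2 hu2
  have hF : ∫ z, (inner ℝ (u z) (w z) + ‖v z‖ ^ 2) = 0 := by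
    refine integral_eq_zero_of_hasDerivAt_of_integrable
      (f := fun z => inner ℝ (u z) (v z)) (fun z => ?_) (hiuw.add hiv) hiuv
    simpa [real_inner_self_eq_norm_sq] using (hu z).inner ℝ (hv z)
  have hG : ∫ z, (‖u z‖ ^ 2 + 2 * inner ℝ (z • u z) (v z)) = 0 := by
    refine integral_eq_zero_of_hasDerivAt_of_integrable
      (f := fun z => inner ℝ (z • u z) (u z)) (fun z => ?_) (hiu.add (hizuv.const_mul 2)) hizuu
    have hd : HasDerivAt (fun z => z • u z) (z • v z + (1 : ℝ) • u z) z :=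
      (hasDerivAt_id' z).smul (hu z)
    have hd' := hd.inner ℝ (hu z)
    rw [inner_add_left, real_inner_smul_left, real_inner_smul_left, real_inner_smul_left,
      real_inner_self_eq_norm_sq, real_inner_comm (u z) (v z)] at hd'
    rw [real_inner_smul_left]
    exact hd'.congr_deriv (by ring)
  rw [integral_add hiuw hiv] at hF
  rw [integral_add hiu (hizuv.const_mul 2), integral_const_mul] at hG
  set A := ∫ z, ‖u z‖ ^ 2 with hA
  set D := ∫ z, ‖v z‖ ^ 2 with hD
  set N := ∫ z, ‖h z‖ ^ 2 with hN
  set Z := ∫ z, ‖z • u z‖ ^ 2 with hZ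
  set P := ∫ z, inner ℝ (z • u z) (v z) with hP
  have hA0 : 0 ≤ A := integral_nonneg fun z => by positivity
  have hZ0 : 0 ≤ Z := integral_nonneg fun z => by positivity
  have hN0 : 0 ≤ N := integral_nonneg fun z => by positivity
  have hQ : ∫ z, inner ℝ (u z) (h z) = (l - ω) * A + ω ^ 2 * Z + D := by
    have : ∀ z, inner ℝ (u z) (h z)
        = (l - ω) * ‖u z‖ ^ 2 + ω ^ 2 * ‖z • u z‖ ^ 2 - inner ℝ (u z) (w z) := by
      intro z
      rw [hh, inner_sub_right, inner_smul_right, real_inner_self_eq_norm_sq, norm_smul, mul_pow,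
        Real.norm_eq_abs, sq_abs]
      ring
    simp_rw [this]
    have hi : Integrable (fun z => (l - ω) * ‖u z‖ ^ 2 + ω ^ 2 * ‖z • u z‖ ^ 2) :=
      (hiu.const_mul _).add (hizu.const_mul _)
    rw [integral_sub hi hiuw,
      integral_add (hiu.const_mul _) (hizu.const_mul _), integral_const_mul, integral_const_mul]
    linarith
  have hpos : 0 ≤ D + 2 * ω * P + ω ^ 2 * Z := by
    have h0 : 0 ≤ ∫ z, ‖v z + ω • (z • u z)‖ ^ 2 := integral_nonneg fun z => by positivity
    have : ∀ z, ‖v z + ω • (z • u z)‖ ^ 2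
        = ‖v z‖ ^ 2 + 2 * ω * inner ℝ (z • u z) (v z) + ω ^ 2 * ‖z • u z‖ ^ 2 := by
      intro z
      rw [norm_add_sq_real, inner_smul_right, norm_smul ω, mul_pow, Real.norm_eq_abs ω, sq_abs,
        real_inner_comm]
      ring
    simp_rw [this] at h0
    have hi : Integrable (fun z => ‖v z‖ ^ 2 + 2 * ω * inner ℝ (z • u z) (v z)) :=
      hiv.add (hizuv.const_mul _)
    rwa [integral_add hi (hizu.const_mul _),
      integral_add hiv (hizuv.const_mul _), integral_const_mul, integral_const_mul] at h0
  have hQle : ∫ z, inner ℝ (u z) (h z) ≤ (2 * l)⁻¹ * N + l / 2 * A := by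
    rw [hN, hA, ← integral_const_mul, ← integral_const_mul,
      ← integral_add (hih.const_mul _) (hiu.const_mul _)]
    refine integral_mono hiuh ((hih.const_mul _).add (hiu.const_mul _)) fun z => ?_
    have h1 := real_inner_le_norm (u z) (h z)
    have h2 : (2 * l)⁻¹ * ‖h z‖ ^ 2 + l / 2 * ‖u z‖ ^ 2 - ‖u z‖ * ‖h z‖
        = (2 * l)⁻¹ * (‖h z‖ - l * ‖u z‖) ^ 2 := by
      field_simp
      ring
    have h3 : 0 ≤ (2 * l)⁻¹ * (‖h z‖ - l * ‖u z‖) ^ 2 := by positivity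
    simp only
    linarith
  have hl0 : 0 < l := by linarith
  have hω0 : 0 < ω := by linarith
  have hAle : A ≤ N / l ^ 2 := by
    have h1 : l * A ≤ ∫ z, inner ℝ (u z) (h z) := by nlinarith
    have h2 : l / 2 * A ≤ (2 * l)⁻¹ * N := by linarith
    rw [le_div_iff₀ (by positivity)]
    calc A * l ^ 2 = 2 * l * (l / 2 * A) := by ring
      _ ≤ 2 * l * ((2 * l)⁻¹ * N) := by gcongr
      _ = N := by field_simp
  have hDle : D ≤ 2 * ω * N / l := by
    have h1 : D ≤ (2 * l)⁻¹ * N + l / 2 * A + ω * A := by nlinarith [sq_nonneg ω]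
    calc D ≤ (2 * l)⁻¹ * N + l / 2 * (N / l ^ 2) + ω * (N / l ^ 2) := by
          refine h1.trans ?_
          gcongr
      _ = N / l * (1 + ω / l) := by field_simp; ring
      _ ≤ N / l * (ω + ω / 1) := by gcongr
      _ = 2 * ω * N / l := by ring
  have hsl : 0 < √l := Real.sqrt_pos.2 hl0
  have hsω : 0 < √ω := Real.sqrt_pos.2 hω0
  have hll : √l ^ 2 = l := Real.sq_sqrt hl0.le
  have hωω : √ω ^ 2 = ω := Real.sq_sqrt hω0.le
  calc ‖u a‖ ^ 2 ≤ (√l * √ω) * A + (√l * √ω)⁻¹ * D :=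
        norm_sq_le_of_hasDerivAt hu hu2 hv2 (by positivity) a
    _ ≤ (√l * √ω) * (N / l ^ 2) + (√l * √ω)⁻¹ * (2 * ω * N / l) := by gcongr
    _ = 3 * √ω / (l * √l) * N := by
      generalize √l = s at *
      generalize √ω = t at *
      subst hll hωω
      field_simp
      ring

open LineDeriv FourierTransform SchwartzMap

lemma hasTemperateGrowth_prodMk_const (z : ℝ) :
    (fun x : R2 => ((x, z) : R3)).HasTemperateGrowth := by
  have h : (fun x : R2 => ((x, z) : R3))
      = fun x => ContinuousLinearMap.inl ℝ R2 ℝ x + ((0, z) : R3) := by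
    ext x <;> simp
  rw [h]
  exact (ContinuousLinearMap.inl ℝ R2 ℝ).hasTemperateGrowth.add (.const _)

/-- The restriction of a Schwartz function on `ℝ³` to the plane at height `z`. -/
def slice (z : ℝ) : SchwartzMap R3 ℂ →L[ℂ] SchwartzMap R2 ℂ :=
  SchwartzMap.compCLM ℂ (hasTemperateGrowth_prodMk_const z)
    ⟨1, 1, fun x => by
      have : ‖x‖ ≤ ‖((x, z) : R3)‖ := le_max_left _ _
      linarith⟩

@[simp] lemma slice_apply (z : ℝ) (f : SchwartzMap R3 ℂ) (x : R2) : slice z f x = f (x, z) := rfl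

/-- The partial Fourier transform in the planar variable. -/
def planarFourier (f : SchwartzMap R3 ℂ) (ξ : R2) (z : ℝ) : ℂ := 𝓕 (slice z f) ξ

lemma planarFourier_eq_integral (f : SchwartzMap R3 ℂ) (ξ : R2) (z : ℝ) :
    planarFourier f ξ z = ∫ x, Real.fourierChar (-inner ℝ x ξ) • f (x, z) := by
  rw [planarFourier, SchwartzMap.fourier_coe, Real.fourier_eq]
  rfl

lemma exists_norm_le_planar_decay (f : SchwartzMap R3 ℂ) :
    ∃ C : ℝ, ∀ x z, ‖f (x, z)‖ ≤ C * (1 + ‖x‖) ^ (-3 : ℝ) * (1 + ‖z‖) ^ (-2 : ℝ) := by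
  obtain ⟨C, hC⟩ : ∃ C : ℝ, ∀ p : R3, (1 + ‖p‖) ^ 5 * ‖f p‖ ≤ C := ⟨_, fun p => by
    simpa using SchwartzMap.one_add_le_sup_seminorm_apply (𝕜 := ℝ) (m := (5, 0)) le_rfl le_rfl f p⟩
  refine ⟨C, fun x z => ?_⟩
  have hx : ‖x‖ ≤ ‖((x, z) : R3)‖ := le_max_left _ _
  have hz : ‖z‖ ≤ ‖((x, z) : R3)‖ := le_max_right _ _
  have h1 : (1 + ‖x‖) ^ 3 * (1 + ‖z‖) ^ 2 * ‖f (x, z)‖ ≤ C := by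
    refine le_trans ?_ (hC (x, z))
    rw [show (1 + ‖((x, z) : R3)‖) ^ 5
      = (1 + ‖((x, z) : R3)‖) ^ 3 * (1 + ‖((x, z) : R3)‖) ^ 2 by ring]
    gcongr
  have h3 : (1 + ‖x‖) ^ (-3 : ℝ) = ((1 + ‖x‖) ^ 3)⁻¹ := by
    rw [Real.rpow_neg (by positivity)]; norm_cast
  have h2 : (1 + ‖z‖) ^ (-2 : ℝ) = ((1 + ‖z‖) ^ 2)⁻¹ := by
    rw [Real.rpow_neg (by positivity)]; norm_cast
  rw [h3, h2, ← div_eq_mul_inv, ← div_eq_mul_inv, div_div, le_div_iff₀ (by positivity)]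
  linarith

lemma integrable_planar_weight : Integrable (fun x : R2 => (1 + ‖x‖) ^ (-3 : ℝ)) :=
  integrable_one_add_norm (by simp; norm_num)

lemma hasDerivAt_planarFourier (f : SchwartzMap R3 ℂ) (ξ : R2) (z : ℝ) :
    HasDerivAt (planarFourier f ξ) (planarFourier (∂_{ez} f) ξ z) z := by
  have hF : planarFourier f ξ
      = fun z => ∫ x, Real.fourierChar (-inner ℝ x ξ) • f (x, z) :=
    funext fun z => planarFourier_eq_integral f ξ z
  rw [hF, planarFourier_eq_integral]
  have hcont : ∀ (g : SchwartzMap R3 ℂ) (z : ℝ),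
      Continuous fun x : R2 => Real.fourierChar (-inner ℝ x ξ) • g (x, z) := fun g z => by
    have := g.continuous
    have := Real.continuous_fourierChar
    fun_prop
  obtain ⟨C, hC⟩ := exists_norm_le_planar_decay (∂_{ez} f)
  refine (hasDerivAt_integral_of_dominated_loc_of_deriv_le (s := Set.univ)
    (F := fun z (x : R2) => Real.fourierChar (-inner ℝ x ξ) • f (x, z))
    (F' := fun z (x : R2) => Real.fourierChar (-inner ℝ x ξ) • (∂_{ez} f) (x, z))
    (bound := fun x : R2 => C * (1 + ‖x‖) ^ (-3 : ℝ)) Filter.univ_mem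
    (Filter.Eventually.of_forall fun z => (hcont f z).aestronglyMeasurable) ?_
    (hcont _ z).aestronglyMeasurable ?_ (integrable_planar_weight.const_mul C) ?_).2
  · refine ((slice z f).integrable (μ := volume)).norm.mono' (hcont f z).aestronglyMeasurable ?_
    exact Filter.Eventually.of_forall fun x => by simp [Circle.norm_smul]
  · refine Filter.Eventually.of_forall fun x z _ => ?_
    rw [Circle.norm_smul]
    have h0 : 0 ≤ C * (1 + ‖x‖) ^ (-3 : ℝ) := by
      have h := (norm_nonneg _).trans (hC x z)
      exact nonneg_of_mul_nonneg_left h (by positivity)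
    refine (hC x z).trans (mul_le_of_le_one_right h0 ?_)
    exact Real.rpow_le_one_of_one_le_of_nonpos (by linarith [norm_nonneg z]) (by norm_num)
  · refine Filter.Eventually.of_forall fun x z _ => ?_
    refine HasDerivAt.fun_const_smul _ ?_
    have h1 : HasDerivAt (fun z : ℝ => ((x, z) : R3)) ez z :=
      (hasDerivAt_const z x).prodMk (hasDerivAt_id z)
    exact (f.differentiableAt (x := (x, z))).hasFDerivAt.comp_hasDerivAt z h1

lemma memLp_planarFourier (f : SchwartzMap R3 ℂ) (ξ : R2) :
    MemLp (planarFourier f ξ) 2 := by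
  obtain ⟨C, hC⟩ := exists_norm_le_planar_decay f
  have hcont : Continuous (planarFourier f ξ) :=
    continuous_iff_continuousAt.2 fun z => (hasDerivAt_planarFourier f ξ z).continuousAt
  have hb : ∀ z, ‖planarFourier f ξ z‖
      ≤ (∫ x : R2, C * (1 + ‖x‖) ^ (-3 : ℝ)) * (1 + ‖z‖) ^ (-2 : ℝ) := fun z => by
    rw [planarFourier_eq_integral, ← integral_mul_const]
    refine norm_integral_le_of_norm_le ((integrable_planar_weight.const_mul C).mul_const _) ?_
    exact Filter.Eventually.of_forall fun x => by simpa [Circle.norm_smul] using hC x z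
  have hi : Integrable (fun z : ℝ => (1 + ‖z‖) ^ (-4 : ℝ)) :=
    integrable_one_add_norm (by simp)
  rw [memLp_two_iff_integrable_sq_norm hcont.aestronglyMeasurable]
  refine (hi.const_mul ((∫ x : R2, C * (1 + ‖x‖) ^ (-3 : ℝ)) ^ 2)).mono'
    (by fun_prop) (Filter.Eventually.of_forall fun z => ?_)
  rw [Real.norm_of_nonneg (by positivity)]
  refine (pow_le_pow_left₀ (norm_nonneg _) (hb z) 2).trans_eq ?_
  rw [mul_pow, ← Real.rpow_natCast ((1 + ‖z‖) ^ (-2 : ℝ)), ← Real.rpow_mul (by positivity)]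
  norm_num

/-- The operator `S²` acting on Schwartz functions. -/
def S2Schwartz (ω : ℝ) (f : SchwartzMap R3 ℂ) : SchwartzMap R3 ℂ :=
  ((1 - ω : ℝ) : ℂ) • f - (∂_{ex0} (∂_{ex0} f) + ∂_{ex1} (∂_{ex1} f) + ∂_{ez} (∂_{ez} f))
    + ((ω ^ 2 : ℝ) : ℂ) • smulLeftCLM ℂ (fun p : R3 => p.2) (smulLeftCLM ℂ (fun p : R3 => p.2) f)

lemma hasTemperateGrowth_snd : (fun p : R3 => p.2).HasTemperateGrowth :=
  (ContinuousLinearMap.snd ℝ R2 ℝ).hasTemperateGrowth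

lemma S2Schwartz_apply (ω : ℝ) (f : SchwartzMap R3 ℂ) (p : R3) :
    S2Schwartz ω f p = S2op ω f p := by
  simp only [S2Schwartz, S2op, lap3, add_apply, sub_apply,
    smul_apply, SchwartzMap.smulLeftCLM_apply_apply hasTemperateGrowth_snd,
    Complex.real_smul, smul_eq_mul]
  have h : ∀ v : R3, ∂_{v} (∂_{v} f) p = pd2 v f p := fun v => rfl
  simp only [h]
  push_cast
  ring

lemma planarFourier_add (f g : SchwartzMap R3 ℂ) (ξ : R2) (z : ℝ) :
    planarFourier (f + g) ξ z = planarFourier f ξ z + planarFourier g ξ z := by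
  simp [planarFourier, FourierTransform.fourier_add]

lemma planarFourier_smul (c : ℂ) (f : SchwartzMap R3 ℂ) (ξ : R2) (z : ℝ) :
    planarFourier (c • f) ξ z = c * planarFourier f ξ z := by
  simp [planarFourier, FourierTransform.fourier_smul]

lemma planarFourier_sub (f g : SchwartzMap R3 ℂ) (ξ : R2) (z : ℝ) :
    planarFourier (f - g) ξ z = planarFourier f ξ z - planarFourier g ξ z := by
  rw [sub_eq_add_neg, ← neg_one_smul ℂ g, planarFourier_add, planarFourier_smul]
  ring

lemma planarFourier_smulLeft_snd (f : SchwartzMap R3 ℂ) (ξ : R2) (z : ℝ) :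
    planarFourier (smulLeftCLM ℂ (fun p : R3 => p.2) f) ξ z = z • planarFourier f ξ z := by
  have h : slice z (smulLeftCLM ℂ (fun p : R3 => p.2) f) = (z : ℂ) • slice z f := by
    ext x
    simp [SchwartzMap.smulLeftCLM_apply_apply hasTemperateGrowth_snd]
  simp [planarFourier, h, FourierTransform.fourier_smul]

lemma planarFourier_lineDeriv (f : SchwartzMap R3 ℂ) (m ξ : R2) (z : ℝ) :
    planarFourier (∂_{((m, 0) : R3)} f) ξ z
      = 2 * Real.pi * Complex.I * (inner ℝ ξ m : ℝ) * planarFourier f ξ z := by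
  have h : slice z (∂_{((m, 0) : R3)} f) = ∂_{m} (slice z f) := by
    ext x
    have h1 : HasFDerivAt (fun x : R2 => ((x, z) : R3)) (ContinuousLinearMap.inl ℝ R2 ℝ) x :=
      hasFDerivAt_prodMk_left x z
    have h2 := ((f.differentiableAt (x := (x, z))).hasFDerivAt.comp x h1).fderiv
    rw [slice_apply, SchwartzMap.lineDerivOp_apply_eq_fderiv,
      SchwartzMap.lineDerivOp_apply_eq_fderiv]
    change _ = fderiv ℝ (f ∘ fun x : R2 => ((x, z) : R3)) x m
    rw [h2]
    simp
  rw [planarFourier, h, SchwartzMap.fourier_lineDerivOp_eq]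
  simp [SchwartzMap.smulLeftCLM_apply_apply (Function.hasTemperateGrowth_inner_left m),
    planarFourier]
  ring

lemma planarFourier_S2Schwartz (ω : ℝ) (f : SchwartzMap R3 ℂ) (ξ : R2) (z : ℝ) :
    planarFourier (S2Schwartz ω f) ξ z
      = ((1 + 4 * Real.pi ^ 2 * ‖ξ‖ ^ 2) - ω + ω ^ 2 * z ^ 2) • planarFourier f ξ z
        - planarFourier (∂_{ez} (∂_{ez} f)) ξ z := by
  have hn : ((‖ξ‖ ^ 2 : ℝ) : ℂ) = (ξ 0 : ℂ) ^ 2 + (ξ 1 : ℂ) ^ 2 := by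
    rw [EuclideanSpace.real_norm_sq_eq]
    simp
  simp only [S2Schwartz, planarFourier_add, planarFourier_sub, planarFourier_smul,
    planarFourier_smulLeft_snd, ex0, ex1, planarFourier_lineDeriv, Complex.real_smul]
  simp only [EuclideanSpace.inner_single_right]
  push_cast at hn ⊢
  rw [hn]
  simp
  linear_combination (-4 * Real.pi ^ 2 * planarFourier f ξ z * ((ξ 0 : ℂ) ^ 2 + (ξ 1 : ℂ) ^ 2)) * Complex.I_sq

lemma lintegral_planarFourier_sq (g : SchwartzMap R3 ℂ) (z : ℝ) :
    ∫⁻ ξ, ‖planarFourier g ξ z‖ₑ ^ 2 = ∫⁻ x, ‖g (x, z)‖ₑ ^ 2 := by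
  have key : ∀ φ : SchwartzMap R2 ℂ,
      ∫⁻ x, ‖φ x‖ₑ ^ 2 = ENNReal.ofReal (∫ x, ‖φ x‖ ^ 2) := fun φ => by
    have hφ := (memLp_two_iff_integrable_sq_norm (φ.memLp 2).1).1 (φ.memLp 2)
    rw [ofReal_integral_eq_lintegral_ofReal hφ
      (Filter.Eventually.of_forall fun x => by positivity)]
    simp [ENNReal.ofReal_pow]
  have h := key (slice z g)
  rw [← SchwartzMap.integral_norm_sq_fourier, ← key] at h
  exact h.symm

lemma enorm_le_lintegral_planarFourier (f : SchwartzMap R3 ℂ) (x : R2) (z : ℝ) :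
    ‖f (x, z)‖ₑ ≤ ∫⁻ ξ, ‖planarFourier f ξ z‖ₑ := by
  have h : f (x, z) = 𝓕⁻ (𝓕 (slice z f)) x := by
    rw [FourierTransform.fourierInv_fourier_eq, slice_apply]
  rw [h, SchwartzMap.fourierInv_coe, Real.fourierInv_eq]
  refine (enorm_integral_le_lintegral_enorm _).trans_eq ?_
  refine lintegral_congr fun ξ => ?_
  rw [← ofReal_norm, Circle.norm_smul, ofReal_norm]
  rfl

lemma measurable_planarFourier (g : SchwartzMap R3 ℂ) :
    Measurable fun q : R2 × ℝ => planarFourier g q.1 q.2 := by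
  simp_rw [planarFourier_eq_integral]
  have hcont : Continuous fun r : (R2 × ℝ) × R2 =>
      Real.fourierChar (-inner ℝ r.2 r.1.1) • g (r.2, r.1.2) := by
    have := g.continuous
    have := Real.continuous_fourierChar
    fun_prop
  exact (hcont.stronglyMeasurable.integral_prod_right' (ν := volume)).measurable

/-- The symbol of `1 - Δ_x` in the planar Fourier variable. -/
def planarSymbol (ξ : R2) : ℝ := 1 + 4 * Real.pi ^ 2 * ‖ξ‖ ^ 2

lemma one_le_planarSymbol (ξ : R2) : 1 ≤ planarSymbol ξ := by
  have : 0 ≤ 4 * Real.pi ^ 2 * ‖ξ‖ ^ 2 := by positivity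
  unfold planarSymbol
  linarith

/-- The weight `3 l^{-3/2}`, with `l` the planar symbol. -/
def planarWeight (ξ : R2) : ℝ := 3 / (planarSymbol ξ * √(planarSymbol ξ))

lemma planarWeight_nonneg (ξ : R2) : 0 ≤ planarWeight ξ := by
  have := one_le_planarSymbol ξ
  unfold planarWeight
  positivity

lemma measurable_planarWeight : Measurable planarWeight := by
  unfold planarWeight planarSymbol
  fun_prop

lemma lintegral_planarWeight_ne_top : ∫⁻ ξ, ENNReal.ofReal (planarWeight ξ) ≠ ⊤ := by
  have hi : Integrable (fun ξ : R2 => ((1 : ℝ) + ‖ξ‖ ^ 2) ^ (-(3 : ℝ) / 2)) :=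
    integrable_rpow_neg_one_add_norm_sq (by simp; norm_num)
  have hw : Integrable planarWeight := by
    refine (hi.const_mul 3).mono' measurable_planarWeight.aestronglyMeasurable
      (Filter.Eventually.of_forall fun ξ => ?_)
    rw [Real.norm_of_nonneg (planarWeight_nonneg ξ)]
    have hle : 1 + ‖ξ‖ ^ 2 ≤ planarSymbol ξ := by
      have : 1 ≤ 4 * Real.pi ^ 2 := by nlinarith [Real.pi_gt_three]
      unfold planarSymbol
      nlinarith [sq_nonneg ‖ξ‖]
    have h1 : (1 + ‖ξ‖ ^ 2) ^ (-(3 : ℝ) / 2) = ((1 + ‖ξ‖ ^ 2) * √(1 + ‖ξ‖ ^ 2))⁻¹ := by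
      rw [neg_div, Real.rpow_neg (by positivity), Real.sqrt_eq_rpow,
        ← Real.rpow_one_add' (by positivity) (by norm_num)]
      norm_num
    rw [h1, planarWeight, div_eq_mul_inv]
    have := one_le_planarSymbol ξ
    gcongr
  rw [← ofReal_integral_eq_lintegral_ofReal hw (Filter.Eventually.of_forall planarWeight_nonneg)]
  exact ENNReal.ofReal_ne_top

lemma enorm_planarFourier_le {ω : ℝ} (hω : 1 ≤ ω) (f : SchwartzMap R3 ℂ) (ξ : R2) (z : ℝ) :
    ‖planarFourier f ξ z‖ₑ ≤ (ENNReal.ofReal (√ω) * ENNReal.ofReal (planarWeight ξ)) ^ (1 / 2 : ℝ)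
      * (∫⁻ t, ‖planarFourier (S2Schwartz ω f) ξ t‖ₑ ^ 2) ^ (1 / 2 : ℝ) := by
  have hzu : MemLp (fun z : ℝ => z • planarFourier f ξ z) 2 := by
    simpa only [← planarFourier_smulLeft_snd] using
      memLp_planarFourier (smulLeftCLM ℂ (fun p : R3 => p.2) f) ξ
  have hh2 := memLp_planarFourier (S2Schwartz ω f) ξ
  have hmain := norm_sq_le_of_oscillator hω (one_le_planarSymbol ξ)
    (hasDerivAt_planarFourier f ξ) (hasDerivAt_planarFourier (∂_{ez} f) ξ)
    (memLp_planarFourier f ξ) (memLp_planarFourier _ ξ) (memLp_planarFourier _ ξ) hzu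
    hh2 (fun z => planarFourier_S2Schwartz ω f ξ z) z
  have hi := (memLp_two_iff_integrable_sq_norm hh2.1).1 hh2
  have hN : ENNReal.ofReal (∫ t, ‖planarFourier (S2Schwartz ω f) ξ t‖ ^ 2)
      = ∫⁻ t, ‖planarFourier (S2Schwartz ω f) ξ t‖ₑ ^ 2 := by
    rw [ofReal_integral_eq_lintegral_ofReal hi
      (Filter.Eventually.of_forall fun x => by positivity)]
    simp [ENNReal.ofReal_pow]
  rw [← ENNReal.mul_rpow_of_nonneg _ _ (by norm_num), ← hN,
    ← ENNReal.ofReal_mul (by positivity), ← ENNReal.ofReal_mul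
      (mul_nonneg (by positivity) (planarWeight_nonneg ξ)), one_div,
    ENNReal.le_rpow_inv_iff (by norm_num), ← ofReal_norm,
    ENNReal.ofReal_rpow_of_nonneg (norm_nonneg _) (by norm_num)]
  refine ENNReal.ofReal_le_ofReal ?_
  rw [Real.rpow_two]
  refine hmain.trans_eq ?_
  unfold planarWeight
  ring

lemma enorm_le_eLpNorm_S2Schwartz {ω : ℝ} (hω : 1 ≤ ω) (f : SchwartzMap R3 ℂ) (p : R3) :
    ‖f p‖ₑ ≤ (ENNReal.ofReal (√ω) * ∫⁻ ξ, ENNReal.ofReal (planarWeight ξ)) ^ (1 / 2 : ℝ)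
      * eLpNorm (S2Schwartz ω f) 2 volume := by
  obtain ⟨x, z⟩ := p
  have hpt := enorm_planarFourier_le hω f
  generalize S2Schwartz ω f = g at hpt ⊢
  have hm : Measurable fun q : R2 × ℝ => ‖planarFourier g q.1 q.2‖ₑ ^ 2 :=
    (measurable_planarFourier g).enorm.pow_const 2
  have hnorm : eLpNorm g 2 volume
      = (∫⁻ ξ, ∫⁻ t, ‖planarFourier g ξ t‖ₑ ^ 2) ^ (1 / 2 : ℝ) := by
    rw [eLpNorm_eq_lintegral_rpow_enorm_toReal (by norm_num) (by norm_num)]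
    simp only [ENNReal.toReal_ofNat, ENNReal.rpow_two]
    congr 1
    rw [lintegral_lintegral_swap hm.aemeasurable, Measure.volume_eq_prod,
      lintegral_prod_symm _ (g.continuous.enorm.measurable.pow_const 2).aemeasurable]
    exact lintegral_congr fun t => (lintegral_planarFourier_sq g t).symm
  calc ‖f (x, z)‖ₑ ≤ ∫⁻ ξ, ‖planarFourier f ξ z‖ₑ := enorm_le_lintegral_planarFourier f x z
    _ ≤ ∫⁻ ξ, (ENNReal.ofReal (√ω) * ENNReal.ofReal (planarWeight ξ)) ^ (1 / 2 : ℝ)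
        * (∫⁻ t, ‖planarFourier g ξ t‖ₑ ^ 2) ^ (1 / 2 : ℝ) :=
      lintegral_mono fun ξ => hpt ξ z
    _ ≤ (∫⁻ ξ, ENNReal.ofReal (√ω) * ENNReal.ofReal (planarWeight ξ)) ^ (1 / 2 : ℝ)
        * (∫⁻ ξ, ∫⁻ t, ‖planarFourier g ξ t‖ₑ ^ 2) ^ (1 / 2 : ℝ) :=
      ENNReal.lintegral_mul_norm_pow_le
        (measurable_planarWeight.ennreal_ofReal.const_mul _).aemeasurable
        hm.lintegral_prod_right'.aemeasurable (by norm_num) (by norm_num) (by norm_num)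
    _ = _ := by
      rw [hnorm, lintegral_const_mul _ measurable_planarWeight.ennreal_ofReal]

lemma eLpNorm_top_le_eLpNorm_S2Schwartz {ω : ℝ} (hω : 1 ≤ ω) (f : SchwartzMap R3 ℂ) :
    eLpNorm f ⊤ volume ≤ ENNReal.ofReal (ω ^ ((1 : ℝ) / 4))
      * (∫⁻ ξ, ENNReal.ofReal (planarWeight ξ)) ^ (1 / 2 : ℝ)
      * eLpNorm (S2Schwartz ω f) 2 volume := by
  have hω0 : 0 ≤ ω := by linarith
  have hconst : (ENNReal.ofReal (√ω)) ^ (1 / 2 : ℝ) = ENNReal.ofReal (ω ^ ((1 : ℝ) / 4)) := by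
    rw [ENNReal.ofReal_rpow_of_nonneg (Real.sqrt_nonneg ω) (by norm_num), Real.sqrt_eq_rpow,
      ← Real.rpow_mul hω0]
    norm_num
  rw [eLpNorm_exponent_top, ← hconst, ← ENNReal.mul_rpow_of_nonneg _ _ (by norm_num)]
  exact essSup_le_of_ae_le _
    (Filter.Eventually.of_forall fun p => enorm_le_eLpNorm_S2Schwartz hω f p)

/-- Schwartz functions on ℝ³ have a finite `L²` norm. -/
lemma eLpNorm_two_ne_top (g : SchwartzMap R3 ℂ) :
    eLpNorm g 2 (volume : Measure R3) ≠ ⊤ := by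
  have : (volume : Measure R3).IsAddHaarMeasure :=
    Measure.prod.instIsAddHaarMeasure (volume : Measure R2) (volume : Measure ℝ)
  exact (g.memLp 2 volume).eLpNorm_ne_top

/-- there is `C > 0` such that for every `ω ≥ 1` and every Schwartz
function `f` on ℝ³, `‖f‖_{L^∞} ≤ C ω^{1/4} ‖S²f‖_{L²}`. -/
theorem Linfty_bound :
    ∃ C : ℝ, 0 < C ∧ ∀ ω : ℝ, 1 ≤ ω → ∀ f : SchwartzMap R3 ℂ,
      (eLpNorm (⇑f) ⊤ volume).toReal ≤
        C * ω ^ ((1 : ℝ) / 4) * (eLpNorm (S2op ω (⇑f)) 2 volume).toReal := by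
  obtain ⟨W, hW, hle⟩ : ∃ W : ENNReal, W ≠ ⊤ ∧ ∀ ω : ℝ, 1 ≤ ω → ∀ f : SchwartzMap R3 ℂ,
      eLpNorm f ⊤ volume ≤ ENNReal.ofReal (ω ^ ((1 : ℝ) / 4)) * W
        * eLpNorm (S2Schwartz ω f) 2 volume :=
    ⟨_, ENNReal.rpow_ne_top_of_nonneg (by norm_num) lintegral_planarWeight_ne_top,
      fun _ hω f => eLpNorm_top_le_eLpNorm_S2Schwartz hω f⟩
  refine ⟨W.toReal + 1, by positivity, fun ω hω f => ?_⟩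
  have hS : S2op ω f = S2Schwartz ω f := funext fun p => (S2Schwartz_apply ω f p).symm
  have hω0 : 0 ≤ ω := by linarith
  have hfin : ENNReal.ofReal (ω ^ ((1 : ℝ) / 4)) * W * eLpNorm (S2Schwartz ω f) 2 volume ≠ ⊤ :=
    ENNReal.mul_ne_top (ENNReal.mul_ne_top ENNReal.ofReal_ne_top hW)
      (eLpNorm_two_ne_top _)
  have h := ENNReal.toReal_mono hfin (hle ω hω f)
  rw [ENNReal.toReal_mul, ENNReal.toReal_mul,
    ENNReal.toReal_ofReal (Real.rpow_nonneg hω0 _)] at h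
  rw [hS]
  refine h.trans (mul_le_mul_of_nonneg_right ?_ ENNReal.toReal_nonneg)
  rw [mul_comm]
  exact mul_le_mul_of_nonneg_right (by linarith) (Real.rpow_nonneg hω0 _)
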